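/- Let M be a finite set-homogeneous s-digraph and let α be a vertex of M. Then the s-digraphs induced on Γ(α) and on Γ*(α) are themselves set-homogeneous. -/

import Mathlib

/-- A symmetric digraph (s-digraph): an arc relation and an edge relation on
the vertex type. -/
structure SDigraph (V : Type*) where
  arc : V → V → Prop
  edge : V → V → Prop

namespace SDigraph

variable {V W : Type*}

/-- The s-digraph axioms: arcs are irreflexive and antisymmetric, edges are
irreflexive and symmetric, and no pair of vertices is related by both. -/
def IsS (M : SDigraph V) : Prop :=
  (∀ v, ¬ M.arc v v) ∧ (∀ u v, M.arc u v → ¬ M.arc v u) ∧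
    (∀ v, ¬ M.edge v v) ∧ (∀ u v, M.edge u v → M.edge v u) ∧
    ∀ u v, M.edge u v → ¬ M.arc u v

/-- An s-digraph with no arcs is a graph. -/
def NoArcs (M : SDigraph V) : Prop := ∀ u v, ¬ M.arc u v

/-- An s-digraph with no edges is an a-digraph. -/
def NoEdges (M : SDigraph V) : Prop := ∀ u v, ¬ M.edge u v

/-- Isomorphism of s-digraphs. -/
def Iso (M : SDigraph V) (N : SDigraph W) : Prop :=
  ∃ e : V ≃ W, (∀ u v, M.arc u v ↔ N.arc (e u) (e v)) ∧
    ∀ u v, M.edge u v ↔ N.edge (e u) (e v)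

/-- Induced sub-s-digraph on a set of vertices. -/
def induce (M : SDigraph V) (S : Set V) : SDigraph S :=
  ⟨fun u v => M.arc (u : V) (v : V), fun u v => M.edge (u : V) (v : V)⟩

/-- `g` is an automorphism of `M`. -/
def IsAuto (M : SDigraph V) (g : V ≃ V) : Prop :=
  (∀ u v, M.arc u v ↔ M.arc (g u) (g v)) ∧
    ∀ u v, M.edge u v ↔ M.edge (g u) (g v)

/-- `M` is set-homogeneous: whenever two finite sets of vertices induce
isomorphic sub-s-digraphs, some automorphism maps one set onto the other. -/
def SetHomogeneous (M : SDigraph V) : Prop :=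
  ∀ U U' : Set V, U.Finite → U'.Finite → (M.induce U).Iso (M.induce U') →
    ∃ g : V ≃ V, M.IsAuto g ∧ ⇑g '' U = U'

/-- The complement of an s-digraph: arcs are reversed, and edges are
interchanged with unrelated pairs. -/
def compl (M : SDigraph V) : SDigraph V :=
  ⟨fun u v => M.arc v u,
   fun u v => u ≠ v ∧ ¬ M.edge u v ∧ ¬ M.arc u v ∧ ¬ M.arc v u⟩

/-- The compositional product `M[N]`. -/
def comp (M : SDigraph V) (N : SDigraph W) : SDigraph (V × W) :=
  ⟨fun p q => M.arc p.1 q.1 ∨ (p.1 = q.1 ∧ N.arc p.2 q.2),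
   fun p q => M.edge p.1 q.1 ∨ (p.1 = q.1 ∧ N.edge p.2 q.2)⟩

/-- Γ-connectedness: any two vertices are joined by a path of arcs
(ignoring orientation, and not using edges). -/
def GammaConnected (M : SDigraph V) : Prop :=
  ∀ u v : V, Relation.ReflTransGen (fun a b => M.arc a b ∨ M.arc b a) u v

/-- The complete graph `K_n`, as an s-digraph. -/
def K (n : ℕ) : SDigraph (Fin n) :=
  ⟨fun _ _ => False, fun i j => i ≠ j⟩

/-- The directed triangle `D₃`, as an s-digraph. -/
def D3 : SDigraph (ZMod 3) :=
  ⟨fun i j => j = i + 1, fun _ _ => False⟩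

/-- The s-digraph `E₆`: a directed 6-cycle with edges between opposite
vertices. -/
def E6 : SDigraph (ZMod 6) :=
  ⟨fun i j => j = i + 1, fun i j => j = i + 3 ∨ i = j + 3⟩

/-- The s-digraph `E₇`: a directed 7-cycle with edges `i ∼ i + 3`. -/
def E7 : SDigraph (ZMod 7) :=
  ⟨fun i j => j = i + 1, fun i j => j = i + 3 ∨ i = j + 3⟩

/-- The s-digraph `F₆`: two directed triangles matched by edges. -/
def F6 : SDigraph (Fin 2 × ZMod 3) :=
  ⟨fun p q => p.1 = q.1 ∧ q.2 = p.2 + 1,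
   fun p q => p.1 ≠ q.1 ∧ p.2 = q.2⟩

/-- The s-digraph `J_n`: three independent `n`-element blocks `B₀, B₁, B₂`
with all arcs from `B_i` to `B_{i+1}` except along the matchings, where
there are edges instead. -/
def J (n : ℕ) : SDigraph (ZMod 3 × Fin n) :=
  ⟨fun p q => q.1 = p.1 + 1 ∧ p.2 ≠ q.2,
   fun p q => p.1 ≠ q.1 ∧ p.2 = q.2⟩

/-- The s-digraph `H₁` on 8 vertices (vertices `0`–`7` here standing for
`1`–`8`). -/
def H1 : SDigraph (Fin 8) :=
  ⟨fun p q => (p, q) ∈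
      ([(0, 2), (0, 5), (1, 3), (1, 4), (2, 1), (2, 6), (3, 0), (3, 7),
        (4, 0), (4, 6), (5, 1), (5, 7), (6, 3), (6, 5), (7, 2), (7, 4)] :
        List (Fin 8 × Fin 8)),
   fun p q => (p, q) ∈
      ([(0, 1), (1, 0), (2, 3), (3, 2), (4, 5), (5, 4), (6, 7), (7, 6)] :
        List (Fin 8 × Fin 8))⟩

/-- The mate of a vertex of `H₂` (the unique vertex joined to it by an
edge). -/
def mate (v : Fin 12) : Fin 12 :=
  if v.val % 2 = 0 then v + 1 else v - 1

/-- The twelve basic arcs of `H₂` (vertices `0`–`11` standing for `1`–`12`). -/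
def H2Base : List (Fin 12 × Fin 12) :=
  [(0, 11), (0, 9), (1, 4), (2, 1), (3, 4), (3, 6),
   (5, 6), (7, 8), (8, 5), (10, 7), (10, 9), (11, 2)]

/-- The arcs of `H₂`: the closure of the basic arcs under the rules
"if `v → w` then `w → v′`" and "if `w → v` then `v′ → w`", where `v′` denotes
the mate of `v`. -/
inductive H2Arc : Fin 12 → Fin 12 → Prop
  | base (p q : Fin 12) : (p, q) ∈ H2Base → H2Arc p q
  | fwd (p q : Fin 12) : H2Arc p q → H2Arc q (mate p)
  | bwd (p q : Fin 12) : H2Arc p q → H2Arc (mate q) p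

/-- The s-digraph `H₂` on 12 vertices. -/
def H2 : SDigraph (Fin 12) :=
  ⟨H2Arc, fun p q => q = mate p⟩

/-- The s-digraph `H₃` on the 27 vertices `GF(3)² × GF(3)`: an edge
`(u,α) ∼ (v,β)` iff `u = v` and `α ≠ β`, and an arc `(u,α) → (v,β)` iff
`u ≠ v` and `det(uᵀ vᵀ) = α - β + 1`. -/
def H3 : SDigraph ((Fin 2 → ZMod 3) × ZMod 3) :=
  ⟨fun p q => p.1 ≠ q.1 ∧ p.1 0 * q.1 1 - p.1 1 * q.1 0 = p.2 - q.2 + 1,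
   fun p q => p.1 = q.1 ∧ p.2 ≠ q.2⟩

end SDigraph

open SDigraph

namespace SDigraph

theorem Iso.symm {V W : Type*} {M : SDigraph V} {N : SDigraph W} (h : M.Iso N) : N.Iso M := by
  obtain ⟨e, ha, he⟩ := h
  exact ⟨e.symm, fun u v => by simp [ha], fun u v => by simp [he]⟩

theorem Iso.trans {V W X : Type*} {M : SDigraph V} {N : SDigraph W} {P : SDigraph X}
    (h : M.Iso N) (h' : N.Iso P) : M.Iso P := by
  obtain ⟨e, ha, he⟩ := h
  obtain ⟨e', ha', he'⟩ := h'
  exact ⟨e.trans e', fun u v => (ha u v).trans (ha' _ _), fun u v => (he u v).trans (he' _ _)⟩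

/-- The s-digraph with all arcs reversed. -/
def reverse {V : Type*} (M : SDigraph V) : SDigraph V :=
  ⟨fun u v => M.arc v u, M.edge⟩

theorem Iso.reverse {V W : Type*} {M : SDigraph V} {N : SDigraph W} (h : M.Iso N) :
    M.reverse.Iso N.reverse := by
  obtain ⟨e, ha, he⟩ := h
  exact ⟨e, fun u v => ha v u, he⟩

theorem SetHomogeneous.reverse {V : Type*} {M : SDigraph V} (h : M.SetHomogeneous) :
    M.reverse.SetHomogeneous := by
  intro U U' hU hU' hi
  obtain ⟨g, ⟨ha, he⟩, hg⟩ := h U U' hU hU' hi.reverse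
  exact ⟨g, ⟨fun u v => ha v u, he⟩, hg⟩

theorem IsS.reverse {V : Type*} {M : SDigraph V} (h : M.IsS) : M.reverse.IsS :=
  ⟨h.1, fun u v => h.2.1 v u, h.2.2.1, h.2.2.2.1,
    fun u v huv => h.2.2.2.2 v u (h.2.2.2.1 u v huv)⟩

/-- Inducing twice agrees with inducing once on the image. -/
theorem induce_induce_iso {V : Type*} (M : SDigraph V) (S : Set V) (U : Set S) :
    ((M.induce S).induce U).Iso (M.induce (Subtype.val '' U)) :=
  ⟨Equiv.Set.image _ U Subtype.val_injective, fun _ _ => Iff.rfl, fun _ _ => Iff.rfl⟩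

/-- An isomorphism between subsets of an out-neighbourhood extends by fixing the centre. -/
theorem IsS.iso_insert {V : Type*} {M : SDigraph V} (hM : M.IsS) {α : V} {A B : Set V}
    (hA : ∀ x ∈ A, M.arc α x) (hB : ∀ x ∈ B, M.arc α x)
    (h : (M.induce A).Iso (M.induce B)) :
    (M.induce (insert α A)).Iso (M.induce (insert α B)) := by
  classical
  obtain ⟨hirr, hanti, -, hesymm, hdisj⟩ := hM
  have hαA : α ∉ A := fun hα => hirr _ (hA _ hα)
  have hαB : α ∉ B := fun hα => hirr _ (hB _ hα)
  have edge_left : ∀ x, M.arc α x → ¬ M.edge α x := fun x hx hx' => hdisj _ _ hx' hx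
  have edge_right : ∀ x, M.arc α x → ¬ M.edge x α := fun x hx hx' => edge_left x hx (hesymm _ _ hx')
  obtain ⟨e, ha, he⟩ := h
  let f : (insert α A : Set V) ≃ (insert α B : Set V) :=
    (Equiv.Set.insert hαA).trans ((e.sumCongr (Equiv.refl _)).trans (Equiv.Set.insert hαB).symm)
  have f_center : ∀ hx, (f ⟨α, hx⟩ : V) = α := fun hx => by
    simp [f]
  have f_mem : ∀ x (hx : x ∈ A) hx', (f ⟨x, hx'⟩ : V) = e ⟨x, hx⟩ := fun x hx hx' => by
    have := Equiv.Set.insert_apply_right hαA ⟨x, hx⟩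
    simp [f, this]
  refine ⟨f, ?_, ?_⟩
  · rintro ⟨u, hu⟩ ⟨v, hv⟩
    change M.arc u v ↔ M.arc (f ⟨u, hu⟩) (f ⟨v, hv⟩)
    obtain rfl | huA := id hu <;> obtain rfl | hvA := id hv
    · simp only [f_center]
    · rw [f_center, f_mem v hvA]
      exact iff_of_true (hA v hvA) (hB _ (e ⟨v, hvA⟩).2)
    · rw [f_center, f_mem u huA]
      exact iff_of_false (hanti _ _ (hA u huA)) (hanti _ _ (hB _ (e ⟨u, huA⟩).2))
    · rw [f_mem u huA, f_mem v hvA]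
      exact ha ⟨u, huA⟩ ⟨v, hvA⟩
  · rintro ⟨u, hu⟩ ⟨v, hv⟩
    change M.edge u v ↔ M.edge (f ⟨u, hu⟩) (f ⟨v, hv⟩)
    obtain rfl | huA := id hu <;> obtain rfl | hvA := id hv
    · simp only [f_center]
    · rw [f_center, f_mem v hvA]
      exact iff_of_false (edge_left _ (hA v hvA)) (edge_left _ (hB _ (e ⟨v, hvA⟩).2))
    · rw [f_center, f_mem u huA]
      exact iff_of_false (edge_right _ (hA u huA)) (edge_right _ (hB _ (e ⟨u, huA⟩).2))
    · rw [f_mem u huA, f_mem v hvA]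
      exact he ⟨u, huA⟩ ⟨v, hvA⟩

/-- Out-neighbourhoods inherit set-homogeneity. -/
theorem SetHomogeneous.induce_out {V : Type*} {M : SDigraph V} (hM : M.IsS)
    (hsh : M.SetHomogeneous) (α : V) : (M.induce {x | M.arc α x}).SetHomogeneous := by
  intro U U' hU hU' hi
  set A : Set V := Subtype.val '' U with hAdef
  set B : Set V := Subtype.val '' U' with hBdef
  have hA : ∀ x ∈ A, M.arc α x := by rintro _ ⟨x, -, rfl⟩; exact x.2
  have hB : ∀ x ∈ B, M.arc α x := by rintro _ ⟨x, -, rfl⟩; exact x.2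
  have hαA : α ∉ A := fun hα => hM.1 _ (hA _ hα)
  have hαB : α ∉ B := fun hα => hM.1 _ (hB _ hα)
  obtain ⟨g, ⟨hga, hge⟩, hg⟩ := hsh _ _ ((hU.image _).insert α) ((hU'.image _).insert α)
    (hM.iso_insert hA hB
      (((induce_induce_iso M _ U).symm.trans hi).trans (induce_induce_iso M _ U')))
  have hgα : g α = α := by
    by_contra hne
    have hmem : g α ∈ insert α B := hg ▸ Set.mem_image_of_mem g (Set.mem_insert α A)
    obtain ⟨x, hx, hxα⟩ : α ∈ g '' insert α A := hg ▸ Set.mem_insert α B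
    have h₁ : M.arc α (g α) := hB _ (hmem.resolve_left hne)
    have hxA : x ∈ A := hx.resolve_left fun h => hne (h ▸ hxα)
    have h₂ : M.arc (g α) α := hxα ▸ (hga α x).1 (hA x hxA)
    exact hM.2.1 _ _ h₁ h₂
  have hgAB : g '' A = B := by
    rw [Set.image_insert_eq, hgα] at hg
    have hαgA : α ∉ g '' A := by
      rintro ⟨x, hx, hxα⟩
      exact hαA (g.injective (hxα.trans hgα.symm) ▸ hx)
    rw [← Set.insert_sdiff_self_of_notMem hαgA, hg, Set.insert_sdiff_self_of_notMem hαB]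
  refine ⟨g.subtypeEquiv fun x => ?_, ⟨fun u v => hga u v, fun u v => hge u v⟩, ?_⟩
  · simpa [hgα] using hga α x
  · apply Set.image_injective.2 Subtype.val_injective
    rw [← hBdef, ← hgAB, hAdef, Set.image_image, Set.image_image]
    rfl

end SDigraph

/-- In a finite set-homogeneous s-digraph, the s-digraphs
induced on the out-neighbourhood `Γ(α)` and on the in-neighbourhood `Γ*(α)`
of any vertex are themselves set-homogeneous. -/
theorem induced_neighbourhoods_set_homogeneous
    {V : Type} [Fintype V] (M : SDigraph V) (hM : M.IsS)
    (hsh : M.SetHomogeneous) (α : V) :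
    (M.induce {x | M.arc α x}).SetHomogeneous ∧
      (M.induce {x | M.arc x α}).SetHomogeneous := by
  exact ⟨hsh.induce_out hM α, (hsh.reverse.induce_out hM.reverse α).reverse⟩
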